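/- Let n ≥ d ≥ 1 and r ≥ 0. Let X_{d,n−1}^r be the set of ψ-tableaux X of length r such that (x1) X is contained in δ_{n−1}, (x2) row d of X has length n−d, and (x3) the prime path of row d of X has height d. Let Z_{d,n}^{r+1} be the set of ψ-tableaux Z of length r+1 such that (z1) Z is contained in δ_n, (z2) rows d and d+1 of Z^(r) are identical, (z3) the end-box of the (r+1)-set of Z is (d, n−d+1), and (z4) the prime path of (d, n−d+1) in Z has height d. Then the map X ↦ β_d(α_d(X)) is a bijection from X_{d,n−1}^r to Z_{d,n}^{r+1}. -/

import Mathlib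

/-!
Common definitions for formalizing "A recursion on maximal chains in the Tamari lattices"
(L. Nelson).

* Young diagrams are encoded by their row-length functions `lam : ℕ → ℕ` (rows indexed from 1,
  with `lam 0 = 0`).
* Dyck paths are lists of steps (north/east).
* Tableaux are encoded by entry functions `f : ℕ × ℕ → ℕ` (1-indexed boxes; value `0` means
  "no box").  The label of box `(x, y)` is `f (x, y)`.
-/

noncomputable section

namespace TamariMaxChains

/-- A step of a lattice path: north or east. -/
inductive Step : Type
  | N : Step
  | E : Step
deriving DecidableEq

/-- Number of north steps of a path. -/
def nCount (p : List Step) : ℕ := p.count Step.N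

/-- Number of east steps of a path. -/
def eCount (p : List Step) : ℕ := p.count Step.E

/-- `p` is a Dyck path: equally many norths and easts, and every prefix has at least as many
north steps as east steps (the path never goes below the diagonal `y = x`). -/
def IsDyck (p : List Step) : Prop :=
  nCount p = eCount p ∧ ∀ q : List Step, q <+: p → eCount q ≤ nCount q

/-- `q` is a prime Dyck path: it meets the slope-one line joining its endpoints only at its
endpoints. -/
def IsPrimeDyck (q : List Step) : Prop :=
  q ≠ [] ∧ nCount q = eCount q ∧
    ∀ s : List Step, s <+: q → s ≠ [] → s ≠ q → eCount s < nCount s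

/-- Covering relation of the Tamari lattice on Dyck paths:  `TamariCoverD P' P` means `P'`
covers `P`, i.e. `P'` is obtained from `P` by swapping an east step that is followed by a north
step with the prime Dyck subpath following it. -/
def TamariCoverD (P' P : List Step) : Prop :=
  ∃ a q b : List Step, IsPrimeDyck q ∧
    P = a ++ Step.E :: (q ++ b) ∧ P' = a ++ (q ++ Step.E :: b)

/-- `lam` is the row-length function of a Young diagram: rows are indexed from `1`,
`lam x` is the number of boxes in row `x`, rows weakly decrease, finitely many boxes. -/
def IsDiagram (lam : ℕ → ℕ) : Prop :=
  lam 0 = 0 ∧ (∀ x, 1 ≤ x → lam (x + 1) ≤ lam x) ∧ ∃ N, ∀ x, N ≤ x → lam x = 0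

/-- The height (number of north steps) of the prime path of row `d ≥ 1` of the Young diagram
with row lengths `lam`:  the least `t ≥ 1` such that either `t = d` (row `0` being regarded as
an infinite row of boxes) or row `d - t` has length at least `lam d + t`. -/
def primeHeight (lam : ℕ → ℕ) (d : ℕ) : ℕ :=
  sInf {t | 1 ≤ t ∧ (t = d ∨ (t < d ∧ lam d + t ≤ lam (d - t)))}

/-- The last box of row `d` is a corner box (last box of its row and lowest box of
its column). -/
def IsCorner (lam : ℕ → ℕ) (d : ℕ) : Prop := 1 ≤ d ∧ 1 ≤ lam d ∧ lam (d + 1) < lam d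

/-- The result of removing the `B`-strip of the last box `B` of row `d`: the last box of each of
the rows `d - h + 1, …, d` is removed, where `h` is the height of the prime path of row `d`. -/
def removeStrip (lam : ℕ → ℕ) (d : ℕ) : ℕ → ℕ := fun x =>
  if d + 1 ≤ x + primeHeight lam d ∧ x ≤ d then lam x - 1 else lam x

/-- Covering relation of the Tamari lattice on Young diagrams:  `mu` covers `lam` iff `mu` is
obtained from `lam` by removing the `B`-strip of a corner box `B`. -/
def TamariCoverY (mu lam : ℕ → ℕ) : Prop := ∃ d, IsCorner lam d ∧ mu = removeStrip lam d

/-- The `B`-strip of the last box `B` of row `d`: the set of last boxes of rows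
`d - h + 1, …, d`, where `h` is the height of the prime path of row `d`. -/
def stripSet (lam : ℕ → ℕ) (d : ℕ) : Set (ℕ × ℕ) :=
  {b | b.2 = lam b.1 ∧ 1 ≤ b.2 ∧ d + 1 ≤ b.1 + primeHeight lam d ∧ b.1 ≤ d}

/-- The enclosure of the `B`-strip of the last box `B = (d, lam d)` of row `d`: all boxes
`(x, y)` with `d - h ≤ x ≤ d` and `lam d ≤ y ≤ lam d + h`, where row `0` is regarded as an
infinite row of boxes. -/
def enclosure (lam : ℕ → ℕ) (d : ℕ) : Set (ℕ × ℕ) :=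
  {b | (b.1 = 0 ∨ b.2 ≤ lam b.1) ∧ 1 ≤ b.2 ∧
    d ≤ b.1 + primeHeight lam d ∧ b.1 ≤ d ∧ lam d ≤ b.2 ∧ b.2 ≤ lam d + primeHeight lam d}

/-- The Dyck path of length `2 n` corresponding to the Young diagram `lam` contained in the
staircase `δ_{n-1}` (the Dyck path is the silhouette of the Young diagram). -/
def toDyck (n : ℕ) (lam : ℕ → ℕ) : List Step :=
  ((List.range n).flatMap fun k =>
    List.replicate (lam (n - k) - lam (n - k + 1)) Step.E ++ [Step.N]) ++
    List.replicate (n - lam 1) Step.E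

/-- The prime path of row `d` of the Young diagram `lam`, as its list of steps (read from its
lower-left endpoint). -/
def primePathList (lam : ℕ → ℕ) (d : ℕ) : List Step :=
  Step.N :: ((((List.range (primeHeight lam d - 1)).flatMap fun j =>
    List.replicate (lam (d - 1 - j) - lam (d - j)) Step.E ++ [Step.N])) ++
    List.replicate (lam d + primeHeight lam d - lam (d - (primeHeight lam d - 1))) Step.E)

/-- `S` translates to `S'` by `p` units down and `q` units to the right. -/
def TranslatesBy (p q : ℤ) (S S' : Set (ℕ × ℕ)) : Prop :=
  ∀ x y : ℕ, (x, y) ∈ S' ↔ ∃ a b : ℕ, (a, b) ∈ S ∧ (x : ℤ) = a + p ∧ (y : ℤ) = b + q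

/-- `S` translates to `S'`. -/
def Translates (S S' : Set (ℕ × ℕ)) : Prop := ∃ p q : ℤ, TranslatesBy p q S S'

/-- The length of a tableau: its number of distinct labels (for an honest tableau, labels are
exactly `1, …, tlen f`). -/
def tlen (f : ℕ × ℕ → ℕ) : ℕ := sSup {v | v ≠ 0 ∧ ∃ b, f b = v}

/-- The number of boxes in row `x` of a tableau. -/
def rowLen (f : ℕ × ℕ → ℕ) (x : ℕ) : ℕ := sSup {y | f (x, y) ≠ 0}

/-- The number of boxes in column `y` of a tableau. -/
def colLen (f : ℕ × ℕ → ℕ) (y : ℕ) : ℕ := sSup {x | f (x, y) ≠ 0}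

/-- `f` is (the entry function of) a tableau: the support is a Young diagram (1-indexed),
rows strictly increase, columns weakly increase, and the set of labels is exactly
`{1, …, tlen f}`. -/
def IsTableau (f : ℕ × ℕ → ℕ) : Prop :=
  (∀ y, f (0, y) = 0) ∧ (∀ x, f (x, 0) = 0) ∧
  {b : ℕ × ℕ | f b ≠ 0}.Finite ∧
  (∀ x y x' y', 1 ≤ x' → x' ≤ x → 1 ≤ y' → y' ≤ y → f (x, y) ≠ 0 → f (x', y') ≠ 0) ∧
  (∀ x y, f (x, y) ≠ 0 → f (x, y + 1) ≠ 0 → f (x, y) < f (x, y + 1)) ∧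
  (∀ x y, f (x, y) ≠ 0 → f (x + 1, y) ≠ 0 → f (x, y) ≤ f (x + 1, y)) ∧
  (∀ v, 1 ≤ v → (v ≤ tlen f ↔ ∃ b, f b = v))

/-- `T^(r)`: the subtableau of all entries at most `r`. -/
def trunc (f : ℕ × ℕ → ℕ) (r : ℕ) : ℕ × ℕ → ℕ := fun b => if f b ≤ r then f b else 0

/-- The shape (row-length function) of a tableau. -/
def shapeOf (f : ℕ × ℕ → ℕ) : ℕ → ℕ := fun x => rowLen f x

/-- The row index of the end-box of the `k`-set of `f` (the maximal row index of a box
labeled `k`). -/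
def endRow (f : ℕ × ℕ → ℕ) (k : ℕ) : ℕ := sSup {x | ∃ y, f (x, y) = k}

/-- `Y 0 ⋗ Y 1 ⋗ ⋯ ⋗ Y l` is a saturated chain in the Tamari order on Young diagrams whose
maximal element `Y 0` is the empty diagram (each `Y r` covers `Y (r+1)`). -/
def IsTamariChain (Y : ℕ → ℕ → ℕ) (l : ℕ) : Prop :=
  (∀ r, r ≤ l → IsDiagram (Y r)) ∧ (∀ x, Y 0 x = 0) ∧
    ∀ r, r < l → TamariCoverY (Y r) (Y (r + 1))

/-- The tableau `ψ(C)` of the saturated chain `C = (∅ = Y 0 ⋗ ⋯ ⋗ Y l)`: the boxes removed in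
the transition `Y (r-1) ⋗ Y r` are labeled `r`; that is, each box of `Y l` is labeled by the
least `r` such that the box belongs to `Y r`. -/
def psiFun (Y : ℕ → ℕ → ℕ) (l : ℕ) : ℕ × ℕ → ℕ := fun b =>
  if 1 ≤ b.1 ∧ 1 ≤ b.2 ∧ b.2 ≤ Y l b.1 then sInf {r | r ≤ l ∧ b.2 ≤ Y r b.1} else 0

/-- `f` is a `ψ`-tableau: it is in the image of `ψ`. -/
def IsPsiTab (f : ℕ × ℕ → ℕ) : Prop :=
  ∃ l Y, IsTamariChain Y l ∧ f = psiFun Y l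

/-- Row lengths of the staircase shape `δ_{n-1} = (n-1, n-2, …, 1)`: row `x ≥ 1` has `n - x`
boxes. -/
def dstair (n : ℕ) : ℕ → ℕ := fun x => if x = 0 then 0 else n - x

/-- `C_i(n)`, via `ψ`: the set of maximal chains of length `n + i` in the Tamari lattice `T_n`,
identified with the `ψ`-tableaux of length `n + i` and shape `δ_{n-1}`. -/
def MemC (i : ℤ) (n : ℕ) (f : ℕ × ℕ → ℕ) : Prop :=
  IsTableau f ∧ IsPsiTab f ∧ (∀ x, rowLen f x = dstair n x) ∧ (tlen f : ℤ) = (n : ℤ) + i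

/-- The `r`-set of `f` (of shape `δ_{n-1}`) is a full-set with end-box `(k, n - k)`:
it begins in row `1` and ends in the outer diagonal, at the box `(k, n - k)`. -/
def HasFullSetAt (f : ℕ × ℕ → ℕ) (n r k : ℕ) : Prop :=
  (∃ y, f (1, y) = r) ∧ 1 ≤ k ∧ k ≤ n - 1 ∧ f (k, n - k) = r ∧
    ∀ x y, f (x, y) = r → x ≤ k

/-- `f` has an `r`-full-set. -/
def HasFullSet (f : ℕ × ℕ → ℕ) (n r : ℕ) : Prop := ∃ k, HasFullSetAt f n r k

/-- `f` has an `r⁺`-full-set (plus-full-set): an `r`-full-set whose end-box `(k, n-k)` satisfies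
`k = n - 1`, or `k ≤ n - 2` and the southwest neighbor has a smaller label. -/
def HasPlusFullSet (f : ℕ × ℕ → ℕ) (n r : ℕ) : Prop :=
  ∃ k, HasFullSetAt f n r k ∧ (k = n - 1 ∨ (k ≤ n - 2 ∧ f (k + 1, n - k - 1) < r))

/-- `F_i^r(n)`: the set of `C ∈ C_i(n)` whose `r`-set is a plus-full-set and whose `j`-set is
not a plus-full-set for any `j ∈ [r-1]`. -/
def MemF (i : ℤ) (n : ℕ) (r : ℕ) (f : ℕ × ℕ → ℕ) : Prop :=
  MemC i n f ∧ HasPlusFullSet f n r ∧ ∀ j, 1 ≤ j → j < r → ¬ HasPlusFullSet f n j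

/-- `N_i(n)`: the set of `C ∈ C_i(n)` having no plus-full-sets. -/
def MemN (i : ℤ) (n : ℕ) (f : ℕ × ℕ → ℕ) : Prop :=
  MemC i n f ∧ ∀ r, ¬ HasPlusFullSet f n r

/-- `α_d`: shift all rows of index greater than `d` down one row and repeat row `d` in
row `d + 1`. -/
def alphaFun (d : ℕ) (f : ℕ × ℕ → ℕ) : ℕ × ℕ → ℕ := fun b =>
  if b.1 ≤ d then f b else f (b.1 - 1, b.2)

/-- `β_d`: append a box labeled `tlen f + 1` at the end of each of the rows `1, …, d`. -/
def betaFun (d : ℕ) (f : ℕ × ℕ → ℕ) : ℕ × ℕ → ℕ := fun b =>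
  if 1 ≤ b.1 ∧ b.1 ≤ d ∧ b.2 = rowLen f b.1 + 1 then tlen f + 1 else f b

/-- The number of boxes of row `x` of `f` whose label is at most `r` (these occupy an initial
segment of the row). -/
def lowLen (f : ℕ × ℕ → ℕ) (r x : ℕ) : ℕ := sSup {y | f (x, y) ≠ 0 ∧ f (x, y) ≤ r}

/-- The row index `d` used in the definition of `Ĉ(r)`: the minimal `k ∈ [n-1]` with
`C (k, n-k) ≤ r` if such `k` exists, and `n` otherwise. -/
def hatD (f : ℕ × ℕ → ℕ) (n r : ℕ) : ℕ :=
  sInf ({k | 1 ≤ k ∧ k ≤ n - 1 ∧ 1 ≤ f (k, n - k) ∧ f (k, n - k) ≤ r} ∪ {n})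

/-- `Ĉ(r)` for `C ∈ C_i(n)` and `0 ≤ r ≤ n + i`: starting from `β_d(α_d(C^(r)))` (where `d` is
as in `hatD`), the entries of `C` greater than `r` of row index less than `d` are translated one
unit to the right, those of row index greater than `d` are translated one unit down, and all
these labels are incremented by one. -/
def hatFun (f : ℕ × ℕ → ℕ) (n r : ℕ) : ℕ × ℕ → ℕ := fun b =>
  let d := hatD f n r
  let x := b.1
  let y := b.2
  if x = 0 ∨ y = 0 then 0
  else if x ≤ d then
    if f (x, y) ≠ 0 ∧ f (x, y) ≤ r then f (x, y)
    else if y = lowLen f r x + 1 then r + 1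
    else if r < f (x, y - 1) then f (x, y - 1) + 1
    else 0
  else if x = d + 1 then f (d, y)
  else if f (x - 1, y) = 0 then 0
  else if f (x - 1, y) ≤ r then f (x - 1, y)
  else f (x - 1, y) + 1

/-- `RepBy i m t r C0 C` : `C = (φ_{i,m+t-1}^{r 1} ∘ φ_{i,m+t-2}^{r 2} ∘ ⋯ ∘ φ_{i,m}^{r t}) C0`,
each factor being applied within its domain. -/
def RepBy (i : ℤ) (m t : ℕ) (r : ℕ → ℕ) (C0 C : ℕ × ℕ → ℕ) : Prop :=
  ∃ D : ℕ → ℕ × ℕ → ℕ, D 0 = C0 ∧ D t = C ∧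
    ∀ s, s < t →
      MemC i (m + s) (D s) ∧
      ((r (t - s) : ℤ) ≤ (m : ℤ) + s + i) ∧
      (∀ j, 1 ≤ j → j ≤ r (t - s) → ¬ HasPlusFullSet (D s) (m + s) j) ∧
      D (s + 1) = hatFun (D s) (m + s) (r (t - s))

/-- The set `𝕏_{d,n-1}^r` of Theorem 4.3: `ψ`-tableaux of length `r`, contained in `δ_{n-1}`,
whose row `d` has length `n - d` and whose prime path of row `d` has height `d`. -/
def MemX (d n r : ℕ) (f : ℕ × ℕ → ℕ) : Prop :=
  IsTableau f ∧ IsPsiTab f ∧ tlen f = r ∧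
    (∀ x, 1 ≤ x → rowLen f x ≤ n - x) ∧
    rowLen f d = n - d ∧
    primeHeight (shapeOf f) d = d

/-- The set `ℤ_{d,n}^{r+1}` of Theorem 4.3: `ψ`-tableaux of length `r + 1`, contained in `δ_n`,
such that rows `d` and `d+1` of the truncation at `r` are identical, the end-box of the
`(r+1)`-set is `(d, n-d+1)`, and the prime path of `(d, n-d+1)` has height `d`. -/
def MemZ (d n r : ℕ) (g : ℕ × ℕ → ℕ) : Prop :=
  IsTableau g ∧ IsPsiTab g ∧ tlen g = r + 1 ∧
    (∀ x, 1 ≤ x → rowLen g x ≤ n + 1 - x) ∧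
    (∀ y, trunc g r (d, y) = trunc g r (d + 1, y)) ∧
    g (d, n - d + 1) = r + 1 ∧ (∀ x y, g (x, y) = r + 1 → x ≤ d) ∧
    primeHeight (shapeOf g) d = d

/-- `s` is the row stopping the prime path of row `e` (`0` if there is none). -/
def IsStop (lam : ℕ → ℕ) (e s : ℕ) : Prop :=
  s < e ∧ (∀ a, s < a → a < e → lam a + a < lam e + e) ∧ (s = 0 ∨ lam e + e ≤ lam s + s)

theorem isStop_primeHeight {lam : ℕ → ℕ} {e s : ℕ} (h : IsStop lam e s) :
    s + primeHeight lam e = e := by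
  obtain ⟨h1, h2, h3⟩ := h
  have : primeHeight lam e = e - s := by
    unfold primeHeight
    apply le_antisymm
    · apply Nat.sInf_le
      refine ⟨by omega, ?_⟩
      rcases h3 with h3 | h3
      · left; omega
      · by_cases hs : s = 0
        · left; omega
        · right
          refine ⟨by omega, ?_⟩
          have : e - (e - s) = s := by omega
          rw [this]; omega
    · apply le_csInf
      · exact ⟨e, by omega, Or.inl rfl⟩
      · rintro t ⟨ht1, ht | ⟨ht2, ht3⟩⟩
        · omega
        · by_contra hlt
          have := h2 (e - t) (by omega) (by omega)
          omega
  omega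

theorem exists_isStop (lam : ℕ → ℕ) {e : ℕ} (he : 1 ≤ e) : ∃ s, IsStop lam e s := by
  classical
  let p : ℕ → Prop := fun t => t < e ∧ (e - 1 - t = 0 ∨ lam e + e ≤ lam (e - 1 - t) + (e - 1 - t))
  have hp : ∃ t, p t := ⟨e - 1, by omega, Or.inl (by omega)⟩
  have h1 := Nat.find_spec hp
  refine ⟨e - 1 - Nat.find hp, by have := h1.1; omega, ?_, h1.2⟩
  intro a ha ha'
  have h2 := Nat.find_min hp (m := e - 1 - a) (by have := h1.1; omega)
  by_contra hcon
  apply h2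
  refine ⟨by omega, Or.inr ?_⟩
  have : e - 1 - (e - 1 - a) = a := by omega
  rw [this]; omega

theorem primeHeight_eq_self_iff {lam : ℕ → ℕ} {d : ℕ} (hd : 1 ≤ d) :
    primeHeight lam d = d ↔ ∀ a, 1 ≤ a → a < d → lam a + a < lam d + d := by
  constructor
  · intro h a ha had
    obtain ⟨s, hs⟩ := exists_isStop lam hd
    have := isStop_primeHeight hs
    exact hs.2.1 a (by omega) had
  · intro h
    have : IsStop lam d 0 := ⟨hd, fun a h1 h2 => h a h1 h2, Or.inl rfl⟩
    have := isStop_primeHeight this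
    omega

theorem diagram_anti {lam : ℕ → ℕ} (h : IsDiagram lam) {x y : ℕ} (hx : 1 ≤ x) (hxy : x ≤ y) :
    lam y ≤ lam x := by
  induction y, hxy using Nat.le_induction with
  | base => exact le_rfl
  | succ k hk ih => exact (h.2.1 k (by omega)).trans ih

/-- Subtraction-free version of the covering relation. -/
def Cov (mu lam : ℕ → ℕ) (e s : ℕ) : Prop :=
  IsCorner lam e ∧ IsStop lam e s ∧ ∀ x, lam x = mu x + if s < x ∧ x ≤ e then 1 else 0

theorem cover_iff {mu lam : ℕ → ℕ} (h : IsDiagram lam) :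
    TamariCoverY mu lam ↔ ∃ e s, Cov mu lam e s := by
  constructor
  · rintro ⟨e, hc, rfl⟩
    obtain ⟨s, hs⟩ := exists_isStop lam hc.1
    refine ⟨e, s, hc, hs, ?_⟩
    intro x
    have h1 := isStop_primeHeight hs
    unfold removeStrip
    by_cases hx : s < x ∧ x ≤ e
    · have := diagram_anti h (x := x) (y := e) (by omega) hx.2
      have := hc.2.1
      rw [if_pos hx, if_pos (by omega)]; omega
    · rw [if_neg hx, if_neg (by omega)]; omega
  · rintro ⟨e, s, hc, hs, hx⟩
    refine ⟨e, hc, ?_⟩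
    funext x
    have h1 := isStop_primeHeight hs
    have := hx x
    unfold removeStrip
    by_cases hx : s < x ∧ x ≤ e
    · rw [if_pos hx] at this
      rw [if_pos (by omega)]; omega
    · rw [if_neg hx] at this
      rw [if_neg (by omega)]; omega

/-- Persistence: dominance of row `d` over rows above passes to bigger elements. -/
theorem dom_of_cov {mu lam : ℕ → ℕ} {e s d : ℕ} (h : Cov mu lam e s)
    (hd : ∀ a, 1 ≤ a → a < d → lam a + a < lam d + d) :
    ∀ a, 1 ≤ a → a < d → mu a + a < mu d + d := by
  obtain ⟨hc, ⟨h1, h2, h3⟩, hx⟩ := h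
  intro a ha had
  have e1 := hx a
  have e2 := hx d
  have e3 := hd a ha had
  by_cases hdin : s < d ∧ d ≤ e
  · rw [if_pos hdin] at e2
    by_cases hain : s < a ∧ a ≤ e
    · rw [if_pos hain] at e1; omega
    · rw [if_neg hain] at e1
      have hs : 1 ≤ s := by omega
      have := hd s hs hdin.1
      rcases Nat.lt_or_ge d e with hde | hde
      · have := h2 d hdin.1 hde
        omega
      · have : d = e := by omega
        subst this
        omega
  · rw [if_neg hdin] at e2
    split_ifs at e1 <;> omega

theorem chain_dom {Y : ℕ → ℕ → ℕ} {l d : ℕ} (h : IsTamariChain Y l)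
    (hd : ∀ a, 1 ≤ a → a < d → Y l a + a < Y l d + d) :
    ∀ k q, q + k = l → ∀ a, 1 ≤ a → a < d → Y q a + a < Y q d + d := by
  intro k
  induction k with
  | zero => intro q hq; have : q = l := by omega
            subst this; exact hd
  | succ k ih =>
    intro q hq
    obtain ⟨e, s, hc⟩ := (cover_iff (h.1 (q + 1) (by omega))).1 (h.2.2 q (by omega))
    exact dom_of_cov hc (ih (q + 1) (by omega))

/-- `f` is the tableau of the family `Y 0, …, Y l`. -/
def Rep (f : ℕ × ℕ → ℕ) (Y : ℕ → ℕ → ℕ) (l : ℕ) : Prop :=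
  ∀ x y, f (x, y) ≤ l ∧ ∀ q, q ≤ l →
    ((f (x, y) ≠ 0 ∧ f (x, y) ≤ q) ↔ (1 ≤ x ∧ 1 ≤ y ∧ y ≤ Y q x))

theorem rep_unique {f g : ℕ × ℕ → ℕ} {Y Z : ℕ → ℕ → ℕ} {l : ℕ} (hf : Rep f Y l) (hg : Rep g Z l)
    (hYZ : ∀ q, q ≤ l → ∀ x, 1 ≤ x → Y q x = Z q x) : f = g := by
  funext ⟨x, y⟩
  obtain ⟨f1, f2⟩ := hf x y
  obtain ⟨g1, g2⟩ := hg x y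
  have key : ∀ q, q ≤ l → ((f (x, y) ≠ 0 ∧ f (x, y) ≤ q) ↔ (g (x, y) ≠ 0 ∧ g (x, y) ≤ q)) := by
    intro q hq
    rw [f2 q hq, g2 q hq]
    constructor
    · rintro ⟨a, b, c⟩; exact ⟨a, b, by rw [← hYZ q hq x a]; exact c⟩
    · rintro ⟨a, b, c⟩; exact ⟨a, b, by rw [hYZ q hq x a]; exact c⟩
  have k1 := key _ f1
  have k2 := key _ g1
  omega

theorem chain_step {Y : ℕ → ℕ → ℕ} {l : ℕ} (h : IsTamariChain Y l) {q : ℕ} (hq : q < l) (x : ℕ) :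
    Y q x ≤ Y (q + 1) x ∧ Y (q + 1) x ≤ Y q x + 1 := by
  obtain ⟨e, s, hc⟩ := (cover_iff (h.1 (q + 1) (by omega))).1 (h.2.2 q hq)
  have := hc.2.2 x
  split_ifs at this <;> omega

theorem chain_mono {Y : ℕ → ℕ → ℕ} {l : ℕ} (h : IsTamariChain Y l) {p q : ℕ} (hpq : p ≤ q)
    (hq : q ≤ l) (x : ℕ) : Y p x ≤ Y q x := by
  induction q, hpq using Nat.le_induction with
  | base => exact le_rfl
  | succ k hk ih => exact (ih (by omega)).trans (chain_step h (by omega) x).1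

theorem rep_psi {Y : ℕ → ℕ → ℕ} {l : ℕ} (h : IsTamariChain Y l) : Rep (psiFun Y l) Y l := by
  intro x y
  unfold psiFun
  try dsimp only
  by_cases hb : 1 ≤ x ∧ 1 ≤ y ∧ y ≤ Y l x
  · rw [if_pos hb]
    have hne : {r | r ≤ l ∧ y ≤ Y r x}.Nonempty := ⟨l, le_rfl, hb.2.2⟩
    have hm := Nat.sInf_mem hne
    set m := sInf {r | r ≤ l ∧ y ≤ Y r x} with hmdef
    refine ⟨hm.1, ?_⟩
    intro q hq
    constructor
    · rintro ⟨_, h2⟩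
      exact ⟨hb.1, hb.2.1, hm.2.trans (chain_mono h h2 hq x)⟩
    · rintro ⟨_, _, h3⟩
      refine ⟨?_, Nat.sInf_le ⟨hq, h3⟩⟩
      intro h0
      have := hm.2
      rw [h0, h.2.1 x] at this
      omega
  · rw [if_neg hb]
    refine ⟨by omega, ?_⟩
    intro q hq
    have := chain_mono h hq le_rfl x
    omega

section repfacts
variable {f : ℕ × ℕ → ℕ} {Y : ℕ → ℕ → ℕ} {l : ℕ}

theorem rep_ne (hr : Rep f Y l) (x y : ℕ) : f (x, y) ≠ 0 ↔ (1 ≤ x ∧ 1 ≤ y ∧ y ≤ Y l x) := by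
  obtain ⟨h1, h2⟩ := hr x y
  rw [← h2 l le_rfl]
  exact ⟨fun h => ⟨h, h1⟩, fun h => h.1⟩

theorem rep_rowLen (hr : Rep f Y l) (h : IsTamariChain Y l) (x : ℕ) : rowLen f x = Y l x := by
  unfold rowLen
  by_cases hx : 1 ≤ x ∧ 1 ≤ Y l x
  · apply IsGreatest.csSup_eq
    refine ⟨(rep_ne hr x _).2 ⟨hx.1, hx.2, le_rfl⟩, ?_⟩
    intro y hy
    exact ((rep_ne hr x y).1 hy).2.2
  · have hemp : {y | f (x, y) ≠ 0} = ∅ := by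
      ext y
      have := rep_ne hr x y
      simp only [Set.mem_ofPred_eq, Set.mem_empty_iff_false, iff_false]
      intro hy
      have := this.1 hy
      omega
    rw [hemp]
    have h0 := (h.1 l le_rfl).1
    rcases Nat.eq_zero_or_pos x with rfl | hx1
    · simp [h0]
    · have : Y l x = 0 := by omega
      simp [this]

theorem rep_label (hr : Rep f Y l) (h : IsTamariChain Y l) {v : ℕ} (h1 : 1 ≤ v) (hv : v ≤ l) :
    ∃ b, f b = v := by
  obtain ⟨q, rfl⟩ : ∃ q, v = q + 1 := ⟨v - 1, by omega⟩
  obtain ⟨e, s, hc⟩ := (cover_iff (h.1 (q + 1) hv)).1 (h.2.2 q (by omega))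
  refine ⟨(e, Y (q + 1) e), ?_⟩
  have a1 := hc.2.2 e
  rw [if_pos ⟨hc.2.1.1, le_rfl⟩] at a1
  obtain ⟨b1, b2⟩ := hr e (Y (q + 1) e)
  have c1 := (b2 (q + 1) hv).2 ⟨hc.1.1, hc.1.2.1, le_rfl⟩
  have c2 := (b2 q (by omega)).not.2 (by omega)
  omega

theorem rep_tlen (hr : Rep f Y l) (h : IsTamariChain Y l) : tlen f = l := by
  unfold tlen
  rcases Nat.eq_zero_or_pos l with rfl | hl
  · have hemp : {v | v ≠ 0 ∧ ∃ b, f b = v} = ∅ := by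
      ext v
      simp only [Set.mem_ofPred_eq, Set.mem_empty_iff_false, iff_false]
      rintro ⟨hv, ⟨x, y⟩, rfl⟩
      have := (hr x y).1
      omega
    rw [hemp]; simp
  · apply IsGreatest.csSup_eq
    refine ⟨⟨by omega, rep_label hr h hl le_rfl⟩, ?_⟩
    rintro v ⟨_, ⟨x, y⟩, rfl⟩
    exact (hr x y).1

theorem rep_isTableau (hr : Rep f Y l) (h : IsTamariChain Y l) : IsTableau f := by
  have hD := h.1 l le_rfl
  refine ⟨?_, ?_, ?_, ?_, ?_, ?_, ?_⟩
  · intro y; by_contra hc; have := (rep_ne hr 0 y).1 hc; omega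
  · intro x; by_contra hc; have := (rep_ne hr x 0).1 hc; omega
  · obtain ⟨N, hN⟩ := hD.2.2
    apply Set.Finite.subset ((Set.finite_Iic N).prod (Set.finite_Iic (Y l 1)))
    rintro ⟨x, y⟩ hb
    have hb' := (rep_ne hr x y).1 hb
    constructor
    · by_contra hx
      have := hN x (by simp at hx; omega)
      omega
    · have := diagram_anti hD (le_refl 1) hb'.1
      simp only [Set.mem_Iic]; omega
  · intro x y x' y' hx' hx hy' hy hne
    have := (rep_ne hr x y).1 hne
    have := diagram_anti hD hx' hx
    exact (rep_ne hr x' y').2 ⟨hx', hy', by omega⟩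
  · intro x y hxy hxy1
    obtain ⟨a1, a2⟩ := hr x y
    obtain ⟨b1, b2⟩ := hr x (y + 1)
    obtain ⟨q, hq⟩ : ∃ q, f (x, y + 1) = q + 1 := ⟨f (x, y + 1) - 1, by omega⟩
    have c := (b2 (q + 1) (by omega)).1 ⟨hxy1, by omega⟩
    have st := chain_step h (q := q) (by omega) x
    have hy : 1 ≤ y := ((rep_ne hr x y).1 hxy).2.1
    have := (a2 q (by omega)).2 ⟨c.1, hy, by omega⟩
    omega
  · intro x y hxy hxy1
    obtain ⟨a1, a2⟩ := hr x y
    obtain ⟨b1, b2⟩ := hr (x + 1) y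
    have c := (b2 _ b1).1 ⟨hxy1, le_rfl⟩
    have hx : 1 ≤ x := ((rep_ne hr x y).1 hxy).1
    have := (h.1 _ b1).2.1 x hx
    exact ((a2 _ b1).2 ⟨hx, c.2.1, by omega⟩).2
  · intro v hv
    rw [rep_tlen hr h]
    constructor
    · exact rep_label hr h hv
    · rintro ⟨⟨x, y⟩, rfl⟩; exact (hr x y).1

end repfacts

theorem rep_isPsi {f : ℕ × ℕ → ℕ} {Y : ℕ → ℕ → ℕ} {l : ℕ} (hr : Rep f Y l)
    (h : IsTamariChain Y l) : IsPsiTab f :=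
  ⟨l, Y, h, rep_unique hr (rep_psi h) (fun _ _ _ _ => rfl)⟩

theorem shape_eq {f : ℕ × ℕ → ℕ} {Y : ℕ → ℕ → ℕ} {l : ℕ} (hr : Rep f Y l)
    (h : IsTamariChain Y l) : shapeOf f = Y l := funext (rep_rowLen hr h)

/-- A `ψ`-tableau of length `r` comes from a chain of length `r`. -/
theorem psi_exists {f : ℕ × ℕ → ℕ} {r : ℕ} (h : IsPsiTab f) (hl : tlen f = r) :
    ∃ Y, IsTamariChain Y r ∧ Rep f Y r := by
  obtain ⟨l, Y, hY, rfl⟩ := h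
  have hr := rep_psi hY
  rw [rep_tlen hr hY] at hl
  subst hl
  exact ⟨Y, hY, hr⟩

/-- Repeat row `d`. -/
def aS (d : ℕ) (lam : ℕ → ℕ) : ℕ → ℕ := fun x => if x ≤ d then lam x else lam (x - 1)

/-- Delete row `d + 1`. -/
def dS (d : ℕ) (lam : ℕ → ℕ) : ℕ → ℕ := fun x => if x ≤ d then lam x else lam (x + 1)

theorem aS_le {d x : ℕ} (lam : ℕ → ℕ) (h : x ≤ d) : aS d lam x = lam x := if_pos h
theorem aS_gt {d x : ℕ} (lam : ℕ → ℕ) (h : d < x) : aS d lam x = lam (x - 1) := if_neg (by omega)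
theorem aS_succ {d x : ℕ} (lam : ℕ → ℕ) (h : d ≤ x) : aS d lam (x + 1) = lam x :=
  if_neg (by omega)
theorem dS_le {d x : ℕ} (lam : ℕ → ℕ) (h : x ≤ d) : dS d lam x = lam x := if_pos h
theorem dS_gt {d x : ℕ} (lam : ℕ → ℕ) (h : d < x) : dS d lam x = lam (x + 1) := if_neg (by omega)

theorem isDiagram_aS {d : ℕ} {lam : ℕ → ℕ} (hd : 1 ≤ d) (h : IsDiagram lam) :
    IsDiagram (aS d lam) := by
  refine ⟨by rw [aS_le _ (by omega)]; exact h.1, ?_, ?_⟩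
  · intro x hx
    rcases Nat.lt_trichotomy x d with hxd | rfl | hxd
    · rw [aS_le _ (by omega), aS_le _ (by omega)]; exact h.2.1 x hx
    · rw [aS_succ _ le_rfl, aS_le _ le_rfl]
    · rw [aS_gt _ (by omega), aS_gt _ hxd]
      exact diagram_anti h (by omega) (by omega)
  · obtain ⟨N, hN⟩ := h.2.2
    refine ⟨N + d + 1, fun x hx => ?_⟩
    rw [aS_gt _ (by omega)]; exact hN _ (by omega)

theorem isDiagram_dS {d : ℕ} {lam : ℕ → ℕ} (h : IsDiagram lam) :
    IsDiagram (dS d lam) := by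
  refine ⟨by rw [dS_le _ (by omega)]; exact h.1, ?_, ?_⟩
  · intro x hx
    unfold dS
    split_ifs <;> exact diagram_anti h (by omega) (by omega)
  · obtain ⟨N, hN⟩ := h.2.2
    refine ⟨N + d + 1, fun x hx => ?_⟩
    rw [dS_gt _ (by omega)]; exact hN _ (by omega)

theorem cov_aS {mu lam : ℕ → ℕ} {e s d : ℕ} (hd : 1 ≤ d) (h : Cov mu lam e s)
    (hdom : ∀ a, 1 ≤ a → a < d → lam a + a < lam d + d) :
    ∃ e' s', Cov (aS d mu) (aS d lam) e' s' := by
  obtain ⟨⟨c1, c2, c3⟩, ⟨s1, s2, s3⟩, hx⟩ := h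
  rcases Nat.lt_or_ge e d with hed | hed
  · refine ⟨e, s, ⟨c1, ?_, ?_⟩, ⟨s1, ?_, ?_⟩, ?_⟩
    · rwa [aS_le _ (by omega)]
    · rwa [aS_le _ (by omega), aS_le _ (by omega)]
    · intro a h1 h2
      rw [aS_le _ (by omega), aS_le _ (by omega)]; exact s2 a h1 h2
    · rwa [aS_le _ (by omega), aS_le _ (by omega)]
    · intro x
      rcases Nat.lt_or_ge d x with hxd | hxd
      · rw [aS_gt _ hxd, aS_gt _ hxd, hx, if_neg (by omega), if_neg (by omega)]
      · rw [aS_le _ hxd, aS_le _ hxd, hx]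
  · rcases Nat.lt_or_ge s d with hsd | hsd
    · have hs0 : s = 0 := by
        by_contra hs
        have h1 := hdom s (by omega) hsd
        rcases Nat.lt_or_ge d e with hde | hde
        · have := s2 d hsd hde; omega
        · have : d = e := by omega
          subst this; omega
      subst hs0
      refine ⟨e + 1, 0, ⟨by omega, ?_, ?_⟩, ⟨by omega, ?_, Or.inl rfl⟩, ?_⟩
      · rwa [aS_succ _ hed]
      · rwa [aS_succ _ hed, aS_succ _ (by omega)]
      · intro a h1 h2
        have hde : lam d + d ≤ lam e + e := by
          rcases Nat.lt_or_ge d e with hde | hde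
          · exact (s2 d hsd hde).le
          · have : d = e := by omega
            subst this; exact le_rfl
        rw [aS_succ _ hed]
        rcases Nat.lt_or_ge d a with had | had
        · obtain ⟨a, rfl⟩ : ∃ a', a = a' + 1 := ⟨a - 1, by omega⟩
          rw [aS_succ _ (by omega)]
          have := s2 a (by omega) (by omega)
          omega
        · rw [aS_le _ had]
          rcases Nat.lt_or_ge a d with h3 | h3
          · have := hdom a h1 h3; omega
          · have : a = d := by omega
            subst this; omega
      · intro x
        rcases Nat.lt_or_ge d x with hxd | hxd
        · rw [aS_gt _ hxd, aS_gt _ hxd, hx]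
          congr 1
          apply if_congr _ rfl rfl
          omega
        · rw [aS_le _ hxd, aS_le _ hxd, hx]
          congr 1
          apply if_congr _ rfl rfl
          omega
    · refine ⟨e + 1, s + 1, ⟨by omega, ?_, ?_⟩, ⟨by omega, ?_, Or.inr ?_⟩, ?_⟩
      · rwa [aS_succ _ hed]
      · rwa [aS_succ _ hed, aS_succ _ (by omega)]
      · intro a h1 h2
        obtain ⟨a, rfl⟩ : ∃ a', a = a' + 1 := ⟨a - 1, by omega⟩
        rw [aS_succ _ hed, aS_succ _ (by omega)]
        have := s2 a (by omega) (by omega)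
        omega
      · rw [aS_succ _ hed, aS_succ _ (by omega)]; omega
      · intro x
        rcases Nat.lt_or_ge d x with hxd | hxd
        · rw [aS_gt _ hxd, aS_gt _ hxd, hx]
          congr 1
          apply if_congr _ rfl rfl
          omega
        · rw [aS_le _ hxd, aS_le _ hxd, hx, if_neg (by omega), if_neg (by omega)]

theorem cov_dS {mu lam : ℕ → ℕ} {e s d : ℕ} (hd : 1 ≤ d) (h : Cov mu lam e s)
    (hdom : ∀ a, 1 ≤ a → a < d → lam a + a < lam d + d)
    (hl : lam d = lam (d + 1)) (hm : mu d = mu (d + 1)) :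
    ∃ e' s', Cov (dS d mu) (dS d lam) e' s' := by
  obtain ⟨⟨c1, c2, c3⟩, ⟨s1, s2, s3⟩, hx⟩ := h
  have hed' : e ≠ d := by rintro rfl; omega
  have x1 := hx d
  have x2 := hx (d + 1)
  have hiff : (s < d ∧ d ≤ e) ↔ (s < d + 1 ∧ d + 1 ≤ e) := by
    constructor
    · intro hh; by_contra hc; rw [if_pos hh] at x1; rw [if_neg hc] at x2; omega
    · intro hh; by_contra hc; rw [if_neg hc] at x1; rw [if_pos hh] at x2; omega
  rcases Nat.lt_or_ge e d with hed | hed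
  · refine ⟨e, s, ⟨c1, ?_, ?_⟩, ⟨s1, ?_, ?_⟩, ?_⟩
    · rwa [dS_le _ (by omega)]
    · rwa [dS_le _ (by omega), dS_le _ (by omega)]
    · intro a h1 h2
      rw [dS_le _ (by omega), dS_le _ (by omega)]; exact s2 a h1 h2
    · rwa [dS_le _ (by omega), dS_le _ (by omega)]
    · intro x
      rcases Nat.lt_or_ge d x with hxd | hxd
      · rw [dS_gt _ hxd, dS_gt _ hxd, hx, if_neg (by omega), if_neg (by omega)]
      · rw [dS_le _ hxd, dS_le _ hxd, hx]
  · obtain ⟨e, rfl⟩ : ∃ e', e = e' + 1 := ⟨e - 1, by omega⟩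
    have hdS : ∀ nu : ℕ → ℕ, nu d = nu (d + 1) → ∀ x, d ≤ x → dS d nu x = nu (x + 1) := by
      intro nu hnu x hx
      rcases Nat.lt_or_ge d x with hxd | hxd
      · exact dS_gt _ hxd
      · have : x = d := by omega
        subst this
        rw [dS_le _ le_rfl, hnu]
    have hde : d ≤ e := by omega
    rcases Nat.lt_or_ge s d with hsd | hsd
    · have hdlt : lam d + d ≤ lam (e + 1) + e := by
        have := s2 d hsd (by omega)
        omega
      have hs0 : s = 0 := by
        by_contra hs
        have h1 := hdom s (by omega) hsd
        omega
      subst hs0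
      refine ⟨e, 0, ⟨by omega, ?_, ?_⟩, ⟨by omega, ?_, Or.inl rfl⟩, ?_⟩
      · rwa [hdS _ hl _ hde]
      · rwa [hdS _ hl _ hde, hdS _ hl _ (by omega)]
      · intro a h1 h2
        rw [hdS _ hl _ hde]
        rcases Nat.lt_or_ge a d with had | had
        · rw [dS_le _ (by omega)]
          have := hdom a h1 had
          omega
        · rw [hdS _ hl _ had]
          have := s2 (a + 1) (by omega) (by omega)
          omega
      · intro x
        rcases Nat.lt_or_ge x d with hxd | hxd
        · rw [dS_le _ (by omega), dS_le _ (by omega), hx]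
          congr 1
          apply if_congr _ rfl rfl
          omega
        · rw [hdS _ hl _ hxd, hdS _ hm _ hxd, hx]
          congr 1
          apply if_congr _ rfl rfl
          omega
    · obtain ⟨s, rfl⟩ : ∃ s', s = s' + 1 := ⟨s - 1, by omega⟩
      have hds : d ≤ s := by omega
      refine ⟨e, s, ⟨by omega, ?_, ?_⟩, ⟨by omega, ?_, Or.inr ?_⟩, ?_⟩
      · rwa [hdS _ hl _ hde]
      · rwa [hdS _ hl _ hde, hdS _ hl _ (by omega)]
      · intro a h1 h2
        rw [hdS _ hl _ hde, hdS _ hl _ (by omega)]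
        have := s2 (a + 1) (by omega) (by omega)
        omega
      · rw [hdS _ hl _ hde, hdS _ hl _ hds]; omega
      · intro x
        rcases Nat.lt_or_ge x d with hxd | hxd
        · rw [dS_le _ (by omega), dS_le _ (by omega), hx, if_neg (by omega), if_neg (by omega)]
        · rw [hdS _ hl _ hxd, hdS _ hm _ hxd, hx]
          congr 1
          apply if_congr _ rfl rfl
          omega

/-- The extended chain. -/
def ext (d r : ℕ) (Y : ℕ → ℕ → ℕ) : ℕ → ℕ → ℕ := fun q x =>
  if q ≤ r then aS d (Y q) x else aS d (Y r) x + if 1 ≤ x ∧ x ≤ d then 1 else 0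

theorem ext_le {d r q : ℕ} (Y : ℕ → ℕ → ℕ) (h : q ≤ r) : ext d r Y q = aS d (Y q) := by
  funext x; exact if_pos h

theorem ext_succ {d r : ℕ} (Y : ℕ → ℕ → ℕ) (x : ℕ) :
    ext d r Y (r + 1) x = aS d (Y r) x + if 1 ≤ x ∧ x ≤ d then 1 else 0 := if_neg (by omega)

theorem ext_dom {d r : ℕ} {Y : ℕ → ℕ → ℕ}
    (hdom : ∀ a, 1 ≤ a → a < d → Y r a + a < Y r d + d) :
    ∀ a, 1 ≤ a → a < d → ext d r Y (r + 1) a + a < ext d r Y (r + 1) d + d := by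
  intro a h1 h2
  rw [ext_succ, ext_succ, if_pos (by omega), if_pos (by omega), aS_le _ (by omega),
    aS_le _ le_rfl]
  have := hdom a h1 h2
  omega

theorem chain_ext {d r : ℕ} {Y : ℕ → ℕ → ℕ} (hd : 1 ≤ d) (h : IsTamariChain Y r)
    (hdom : ∀ a, 1 ≤ a → a < d → Y r a + a < Y r d + d) :
    IsTamariChain (ext d r Y) (r + 1) := by
  have hdiag : ∀ q, q ≤ r + 1 → IsDiagram (ext d r Y q) := by
    intro q hq
    rcases Nat.lt_or_ge r q with hqr | hqr
    · have : q = r + 1 := by omega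
      subst this
      have h1 := isDiagram_aS hd (h.1 r le_rfl)
      refine ⟨?_, ?_, ?_⟩
      · rw [ext_succ, h1.1]; simp
      · intro x hx
        rw [ext_succ, ext_succ]
        have := h1.2.1 x hx
        split_ifs <;> omega
      · obtain ⟨N, hN⟩ := h1.2.2
        refine ⟨N + d + 1, fun x hx => ?_⟩
        rw [ext_succ, hN x (by omega), if_neg (by omega)]
    · rw [ext_le _ hqr]
      exact isDiagram_aS hd (h.1 q hqr)
  refine ⟨hdiag, ?_, ?_⟩
  · intro x
    rw [ext_le _ (by omega)]
    unfold aS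
    split_ifs <;> exact h.2.1 _
  · intro q hq
    rw [cover_iff (hdiag _ (by omega))]
    rcases Nat.lt_or_ge q r with hqr | hqr
    · rw [ext_le _ (by omega), ext_le _ (by omega)]
      obtain ⟨e, s, hc⟩ := (cover_iff (h.1 (q + 1) (by omega))).1 (h.2.2 q hqr)
      exact cov_aS hd hc (chain_dom h hdom (r - (q + 1)) (q + 1) (by omega))
    · have : q = r := by omega
      subst this
      refine ⟨d, 0, ⟨hd, ?_, ?_⟩, ⟨hd, fun a h1 h2 => ext_dom hdom a h1 h2, Or.inl rfl⟩, ?_⟩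
      · rw [ext_succ, if_pos (by omega)]; omega
      · rw [ext_succ, ext_succ, if_neg (by omega), if_pos (by omega), aS_succ _ le_rfl,
          aS_le _ le_rfl]
        omega
      · intro x
        rw [ext_succ, ext_le _ le_rfl]
        rfl

theorem rep_alpha {d r : ℕ} {f : ℕ × ℕ → ℕ} {Y : ℕ → ℕ → ℕ} (hd : 1 ≤ d) (hr : Rep f Y r) :
    Rep (alphaFun d f) (fun q => aS d (Y q)) r := by
  intro x y
  unfold alphaFun
  try dsimp only
  rcases Nat.lt_or_ge d x with hxd | hxd
  · rw [if_neg (by omega)]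
    obtain ⟨h1, h2⟩ := hr (x - 1) y
    refine ⟨h1, fun q hq => ?_⟩
    rw [aS_gt _ hxd, h2 q hq]
    omega
  · rw [if_pos hxd]
    obtain ⟨h1, h2⟩ := hr x y
    refine ⟨h1, fun q hq => ?_⟩
    rw [aS_le _ hxd, h2 q hq]

theorem chain_aS {d r : ℕ} {Y : ℕ → ℕ → ℕ} (hd : 1 ≤ d) (h : IsTamariChain Y r)
    (hdom : ∀ a, 1 ≤ a → a < d → Y r a + a < Y r d + d) :
    IsTamariChain (fun q => aS d (Y q)) r := by
  have hc := chain_ext hd h hdom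
  refine ⟨fun q hq => isDiagram_aS hd (h.1 q hq), ?_, ?_⟩
  · intro x
    have := hc.2.1 x
    rwa [ext_le _ (by omega)] at this
  · intro q hq
    have := hc.2.2 q (by omega)
    rwa [ext_le _ (by omega), ext_le _ (by omega)] at this

theorem rep_beta_alpha {d r : ℕ} {f : ℕ × ℕ → ℕ} {Y : ℕ → ℕ → ℕ} (hd : 1 ≤ d)
    (hr : Rep f Y r) (h : IsTamariChain Y r)
    (hdom : ∀ a, 1 ≤ a → a < d → Y r a + a < Y r d + d) :
    Rep (betaFun d (alphaFun d f)) (ext d r Y) (r + 1) := by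
  have ha := rep_alpha hd hr
  have hca := chain_aS hd h hdom
  have hlen := rep_tlen ha hca
  have hrow := rep_rowLen ha hca
  intro x y
  unfold betaFun
  try dsimp only
  rw [hlen, hrow]
  obtain ⟨h1, h2⟩ := ha x y
  by_cases hb : 1 ≤ x ∧ x ≤ d ∧ y = aS d (Y r) x + 1
  · rw [if_pos hb]
    refine ⟨le_rfl, fun q hq => ?_⟩
    rcases Nat.lt_or_ge r q with hqr | hqr
    · have : q = r + 1 := by omega
      subst this
      rw [ext_succ, if_pos (by omega)]
      omega
    · rw [ext_le _ hqr]
      have := chain_mono hca hqr le_rfl x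
      try dsimp only at this
      omega
  · rw [if_neg hb]
    refine ⟨by omega, fun q hq => ?_⟩
    rcases Nat.lt_or_ge r q with hqr | hqr
    · have : q = r + 1 := by omega
      subst this
      rw [ext_succ]
      have := h2 r le_rfl
      try dsimp only at this
      split_ifs <;> omega
    · rw [ext_le _ hqr]
      exact h2 q hqr

/-- The inverse map. -/
def gam (d r : ℕ) (g : ℕ × ℕ → ℕ) : ℕ × ℕ → ℕ := fun b =>
  if b.1 ≤ d then trunc g r b else trunc g r (b.1 + 1, b.2)

theorem rep_trunc {r : ℕ} {g : ℕ × ℕ → ℕ} {W : ℕ → ℕ → ℕ} (hr : Rep g W (r + 1)) :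
    Rep (trunc g r) W r := by
  intro x y
  obtain ⟨h1, h2⟩ := hr x y
  unfold trunc
  try dsimp only
  split_ifs with hc
  · exact ⟨hc, fun q hq => h2 q (by omega)⟩
  · refine ⟨by omega, fun q hq => ?_⟩
    rw [← h2 q (by omega)]
    omega

theorem rep_gam {d r : ℕ} {g : ℕ × ℕ → ℕ} {W : ℕ → ℕ → ℕ} (hr : Rep g W (r + 1)) :
    Rep (gam d r g) (fun q => dS d (W q)) r := by
  have ht := rep_trunc hr
  intro x y
  unfold gam
  try dsimp only
  rcases Nat.lt_or_ge d x with hxd | hxd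
  · rw [if_neg (by omega)]
    obtain ⟨h1, h2⟩ := ht (x + 1) y
    refine ⟨h1, fun q hq => ?_⟩
    rw [dS_gt _ hxd, h2 q hq]
    omega
  · rw [if_pos hxd]
    obtain ⟨h1, h2⟩ := ht x y
    refine ⟨h1, fun q hq => ?_⟩
    rw [dS_le _ hxd, h2 q hq]

theorem gam_beta_alpha {d r : ℕ} {f : ℕ × ℕ → ℕ} {Y : ℕ → ℕ → ℕ} (hd : 1 ≤ d)
    (hr : Rep f Y r) (h : IsTamariChain Y r)
    (hdom : ∀ a, 1 ≤ a → a < d → Y r a + a < Y r d + d) :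
    gam d r (betaFun d (alphaFun d f)) = f := by
  refine rep_unique (rep_gam (rep_beta_alpha hd hr h hdom)) hr ?_
  intro q hq x hx
  try dsimp only
  rw [ext_le _ hq]
  rcases Nat.lt_or_ge d x with hxd | hxd
  · rw [dS_gt _ hxd, aS_succ _ (by omega)]
  · rw [dS_le _ hxd, aS_le _ hxd]

theorem memX_chain {n d r : ℕ} (hd : 1 ≤ d) {f : ℕ × ℕ → ℕ} (h : MemX d n r f) :
    ∃ Y, IsTamariChain Y r ∧ Rep f Y r ∧
      (∀ a, 1 ≤ a → a < d → Y r a + a < Y r d + d) ∧ (∀ x, 1 ≤ x → Y r x ≤ n - x) ∧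
      Y r d = n - d := by
  obtain ⟨_, hpsi, hlen, hle, hrow, hph⟩ := h
  obtain ⟨Y, hY, hr⟩ := psi_exists hpsi hlen
  rw [shape_eq hr hY, primeHeight_eq_self_iff hd] at hph
  refine ⟨Y, hY, hr, hph, ?_, ?_⟩
  · intro x hx; rw [← rep_rowLen hr hY]; exact hle x hx
  · rw [← rep_rowLen hr hY]; exact hrow

theorem mapsTo {n d r : ℕ} (hd : 1 ≤ d) (hdn : d ≤ n) {f : ℕ × ℕ → ℕ} (h : MemX d n r f) :
    MemZ d n r (betaFun d (alphaFun d f)) := by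
  obtain ⟨Y, hY, hr, hdom, hle, hrow⟩ := memX_chain hd h
  have hc := chain_ext hd hY hdom
  have hg := rep_beta_alpha hd hr hY hdom
  set g := betaFun d (alphaFun d f) with hgdef
  refine ⟨rep_isTableau hg hc, rep_isPsi hg hc, rep_tlen hg hc, ?_, ?_, ?_, ?_, ?_⟩
  · intro x hx
    rw [rep_rowLen hg hc, ext_succ]
    rcases Nat.lt_or_ge d x with hxd | hxd
    · rw [aS_gt _ hxd, if_neg (by omega)]
      have := hle (x - 1) (by omega)
      omega
    · rw [aS_le _ hxd, if_pos (by omega)]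
      have := hle x hx
      omega
  · intro y
    have ht := rep_trunc hg
    obtain ⟨a1, a2⟩ := ht d y
    obtain ⟨b1, b2⟩ := ht (d + 1) y
    have key : ∀ q, q ≤ r → ext d r Y q d = ext d r Y q (d + 1) := by
      intro q hq
      rw [ext_le _ hq, aS_le _ le_rfl, aS_succ _ le_rfl]
    have k1 := a2 _ a1
    have k2 := b2 _ a1
    have k3 := a2 _ b1
    have k4 := b2 _ b1
    rw [key _ a1] at k1
    rw [key _ b1] at k3
    omega
  · obtain ⟨a1, a2⟩ := hg d (n - d + 1)
    have k1 := a2 (r + 1) le_rfl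
    have k2 := a2 r (by omega)
    rw [ext_succ, if_pos (by omega), aS_le _ le_rfl] at k1
    rw [ext_le _ le_rfl, aS_le _ le_rfl] at k2
    omega
  · intro x y hxy
    by_contra hcon
    obtain ⟨a1, a2⟩ := hg x y
    have k1 := a2 (r + 1) le_rfl
    have k2 := a2 r (by omega)
    rw [ext_succ, if_neg (by omega)] at k1
    rw [ext_le _ le_rfl] at k2
    omega
  · rw [shape_eq hg hc, primeHeight_eq_self_iff hd]
    exact ext_dom hdom

theorem surj {n d r : ℕ} (hd : 1 ≤ d) (hdn : d ≤ n) {g : ℕ × ℕ → ℕ} (h : MemZ d n r g) :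
    MemX d n r (gam d r g) ∧ betaFun d (alphaFun d (gam d r g)) = g := by
  obtain ⟨_, hpsi, hlen, hle, hrows, hbox, hend, hph⟩ := h
  obtain ⟨W, hW, hg⟩ := psi_exists hpsi hlen
  rw [shape_eq hg hW, primeHeight_eq_self_iff hd] at hph
  have hle' : ∀ x, 1 ≤ x → W (r + 1) x ≤ n + 1 - x := by
    intro x hx; rw [← rep_rowLen hg hW]; exact hle x hx
  -- rows d, d+1 agree in the truncated chain
  have ht := rep_trunc hg
  have hWrow : ∀ q, q ≤ r → W q d = W q (d + 1) := by
    intro q hq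
    have key : ∀ y, 1 ≤ y → (y ≤ W q d ↔ y ≤ W q (d + 1)) := by
      intro y hy
      have k1 := (ht d y).2 q hq
      have k2 := (ht (d + 1) y).2 q hq
      rw [hrows y] at k1
      omega
    have k1 := key (W q d)
    have k2 := key (W q (d + 1))
    omega
  -- the last step
  obtain ⟨e, s, hc, hs, hx⟩ := (cover_iff (hW.1 (r + 1) le_rfl)).1 (hW.2.2 r (by omega))
  have hed : e ≤ d := by
    apply hend e (W (r + 1) e)
    obtain ⟨b1, b2⟩ := hg e (W (r + 1) e)
    have a1 := hx e
    rw [if_pos ⟨hs.1, le_rfl⟩] at a1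
    have c1 := (b2 (r + 1) le_rfl).2 ⟨hc.1, hc.2.1, le_rfl⟩
    have c2 := (b2 r (by omega)).not.2 (by omega)
    omega
  have hbd : n - d + 1 ≤ W (r + 1) d ∧ ¬ (n - d + 1 ≤ W r d) := by
    obtain ⟨b1, b2⟩ := hg d (n - d + 1)
    have k1 := b2 (r + 1) le_rfl
    have k2 := b2 r (by omega)
    omega
  have hde : e = d := by
    have := hx d
    split_ifs at this <;> omega
  subst hde
  have hs0 : s = 0 := by
    by_contra hs0
    have := hph s (by omega) hs.1
    have := hs.2.2
    omega
  subst hs0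
  have hdom : ∀ q, q ≤ r + 1 → ∀ a, 1 ≤ a → a < e → W q a + a < W q e + e := fun q hq =>
    chain_dom hW hph (r + 1 - q) q (by omega)
  have hchain : IsTamariChain (fun q => dS e (W q)) r := by
    refine ⟨fun q hq => isDiagram_dS (hW.1 q (by omega)), ?_, ?_⟩
    · intro x
      try dsimp only
      unfold dS
      split_ifs <;> exact hW.2.1 _
    · intro q hq
      rw [cover_iff (isDiagram_dS (hW.1 _ (by omega)))]
      obtain ⟨e', s', hc'⟩ := (cover_iff (hW.1 (q + 1) (by omega))).1 (hW.2.2 q (by omega))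
      exact cov_dS hd hc' (hdom _ (by omega)) (hWrow _ (by omega)) (hWrow _ (by omega))
  have hf := rep_gam (d := e) hg
  have hdomX : ∀ a, 1 ≤ a → a < e → dS e (W r) a + a < dS e (W r) e + e := by
    intro a h1 h2
    rw [dS_le _ (by omega), dS_le _ le_rfl]
    exact hdom r (by omega) a h1 h2
  refine ⟨⟨rep_isTableau hf hchain, rep_isPsi hf hchain, rep_tlen hf hchain, ?_, ?_, ?_⟩, ?_⟩
  · intro x h1
    rw [rep_rowLen hf hchain]
    try dsimp only
    rcases Nat.lt_or_ge e x with hxd | hxd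
    · rw [dS_gt _ hxd]
      have a1 := hx (x + 1)
      have a2 := hle' (x + 1) (by omega)
      omega
    · rw [dS_le _ hxd]
      have a1 := hx x
      rw [if_pos (by omega)] at a1
      have a2 := hle' x h1
      omega
  · rw [rep_rowLen hf hchain]
    try dsimp only
    rw [dS_le _ le_rfl]
    have a1 := hx e
    rw [if_pos (by omega)] at a1
    omega
  · rw [shape_eq hf hchain, primeHeight_eq_self_iff hd]
    exact hdomX
  · refine rep_unique (rep_beta_alpha hd hf hchain hdomX) hg ?_
    have hback : ∀ q, q ≤ r → ∀ x, aS e (dS e (W q)) x = W q x := by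
      intro q hq x
      rcases Nat.lt_or_ge e x with hxd | hxd
      · rw [aS_gt _ hxd]
        rcases Nat.lt_or_ge e (x - 1) with h3 | h3
        · rw [dS_gt _ h3]; congr 1; omega
        · rw [dS_le _ h3]
          have : x = e + 1 := by omega
          subst this
          exact hWrow q hq
      · rw [aS_le _ hxd, dS_le _ hxd]
    intro q hq x h1
    rcases Nat.lt_or_ge r q with hqr | hqr
    · have : q = r + 1 := by omega
      subst this
      rw [ext_succ, hback r le_rfl, hx x]
      rfl
    · rw [ext_le _ hqr, hback q hqr]

/-- **Theorem 4.3(2).**  For `n ≥ d ≥ 1` and `r ≥ 0`, the map `X ↦ β_d(α_d(X))` is a bijection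
from `𝕏_{d,n-1}^r` to `ℤ_{d,n}^{r+1}`. -/
theorem beta_alpha_bijection (n d r : ℕ) (hd : 1 ≤ d) (hdn : d ≤ n) :
    Set.BijOn (fun f => betaFun d (alphaFun d f))
      {f : ℕ × ℕ → ℕ | MemX d n r f} {g : ℕ × ℕ → ℕ | MemZ d n r g} := by
  refine ⟨fun f hf => mapsTo hd hdn hf, ?_, ?_⟩
  · intro f hf f' hf' heq
    obtain ⟨Y, hY, hr, hdom, _⟩ := memX_chain hd hf
    obtain ⟨Y', hY', hr', hdom', _⟩ := memX_chain hd hf'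
    rw [← gam_beta_alpha hd hr hY hdom, ← gam_beta_alpha hd hr' hY' hdom']
    exact congrArg (gam d r) heq
  · intro g hg
    obtain ⟨h1, h2⟩ := surj hd hdn hg
    exact ⟨gam d r g, h1, h2⟩

end TamariMaxChains
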